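/- Let n=1 and ρ>0. If u∈ℋ^{1,−s} for some s<ρ+1/2 and u satisfies Pu=0 (in the sense of distributions), then ⟨Wu,γ₀⟩=0, where ⟨·,·⟩ is the L²(ℝ²) pairing. -/

import Mathlib

open MeasureTheory Real Complex Filter Topology

noncomputable section

/-- phase space ℝ²: `p.1` = position x, `p.2` = velocity v -/
abbrev Phase := ℝ × ℝ

/-- L²(ℝ²) -/
abbrev Hsp := Lp ℂ 2 (volume : Measure Phase)

/-- ⟨x⟩^s = (1+x²)^{s/2} -/
def jbr (s x : ℝ) : ℝ := (1 + x ^ 2) ^ (s / 2)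

/-- test functions on phase space -/
def IsTest (φ : Phase → ℂ) : Prop := ContDiff ℝ (⊤ : ℕ∞) φ ∧ HasCompactSupport φ

def dxD (u : Phase → ℂ) (p : Phase) : ℂ := fderiv ℝ u p (1, 0)
def dvD (u : Phase → ℂ) (p : Phase) : ℂ := fderiv ℝ u p (0, 1)

/-- formal transpose of P = v∂ₓ − ∂ᵥ² + v²/4 − 1/2 − V′(x)∂ᵥ w.r.t. the pairing ∫ u φ -/
def KFPt (V : ℝ → ℝ) (φ : Phase → ℂ) (p : Phase) : ℂ :=
  -((p.2 : ℂ) * dxD φ p) - dvD (dvD φ) p + ((p.2 ^ 2 / 4 - 1 / 2 : ℝ) : ℂ) * φ p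
    + ((deriv V p.1 : ℝ) : ℂ) * dvD φ p

def psi0 (v : ℝ) : ℝ := (2 * π) ^ (-(1:ℝ)/4) * Real.exp (-(v ^ 2) / 4)

def gam0 (p : Phase) : ℂ := (psi0 p.2 : ℝ)

def gamV (V : ℝ → ℝ) (p : Phase) : ℂ :=
  ((2 * π) ^ (-(1:ℝ)/4) * Real.exp (-(p.2 ^ 2 / 2 + V p.1) / 2) : ℝ)

/-- decay assumption (1.4) on the potential -/
def VDecay (V : ℝ → ℝ) (ρ : ℝ) : Prop :=
  ContDiff ℝ 1 V ∧ ∃ C : ℝ, ∀ x : ℝ, |V x| + jbr 1 x * |deriv V x| ≤ C * jbr (-ρ) x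

/-- Wu = −V′(x) g, where g is the (weak) ∂ᵥ-derivative of u -/
def Wfun (V : ℝ → ℝ) (g : Phase → ℂ) (p : Phase) : ℂ := -((deriv V p.1 : ℝ) : ℂ) * g p

/-- g is the weak ∂ᵥ-derivative of u -/
def WeakDv (u g : Phase → ℂ) : Prop :=
  ∀ φ : Phase → ℂ, IsTest φ → ∫ p : Phase, u p * dvD φ p = -∫ p : Phase, g p * φ p

/-- partial Fourier transform in the x-variable -/
def pftx (w : Phase → ℂ) (q : Phase) : ℂ :=
  ∫ x : ℝ, Complex.exp (-(((2 * π * x * q.1 : ℝ)) : ℂ) * Complex.I) * w (x, q.2)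

/-- the operator ⟨D_x⟩^{1/3} (acting on nice functions) -/
def opLamX (φ : Phase → ℂ) (p : Phase) : ℂ :=
  ∫ ξ : ℝ, Complex.exp ((((2 * π * p.1 * ξ : ℝ)) : ℂ) * Complex.I) *
    (((1 + (2 * π * ξ) ^ 2) ^ ((1:ℝ)/6) : ℝ) : ℂ) * pftx φ (ξ, p.2)

/-- L² norm -/
def L2n (f : Phase → ℂ) : ℝ := (∫ p : Phase, ‖f p‖ ^ 2).sqrt

/-- membership u ∈ ℋ^{1,s}, where g is the weak ∂ᵥ-derivative of u -/
def MemH1 (s : ℝ) (u g : Phase → ℂ) : Prop :=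
  AEStronglyMeasurable u (volume : Measure Phase) ∧
  AEStronglyMeasurable g (volume : Measure Phase) ∧ WeakDv u g ∧
  Integrable (fun p : Phase => ‖u p‖ ^ 2 * jbr (2 * s) p.1) ∧
  Integrable (fun p : Phase => ‖g p‖ ^ 2 * jbr (2 * s) p.1) ∧
  Integrable (fun p : Phase => p.2 ^ 2 * ‖u p‖ ^ 2 * jbr (2 * s) p.1) ∧
  ∃ M : ℝ, ∀ φ : Phase → ℂ, IsTest φ →
    ‖∫ p : Phase, (jbr s p.1 : ℂ) * u p * opLamX φ p‖ ≤ M * L2n φ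

/-- squared ℋ^{1,s}-norm (of a nice function): quadratic form of
(1−Δᵥ+v²+⟨D_x⟩^{2/3}) applied to ⟨x⟩^s h -/
def H1normSq (s : ℝ) (h : Phase → ℂ) : ℝ :=
  (∫ p : Phase, (‖(jbr s p.1 : ℂ) * h p‖ ^ 2
      + ‖dvD (fun q : Phase => (jbr s q.1 : ℂ) * h q) p‖ ^ 2
      + p.2 ^ 2 * ‖(jbr s p.1 : ℂ) * h p‖ ^ 2))
  + ∫ q : Phase, (1 + (2 * π * q.1) ^ 2) ^ ((1:ℝ)/3)
      * ‖pftx (fun p : Phase => (jbr s p.1 : ℂ) * h p) q‖ ^ 2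

def H1norm (s : ℝ) (h : Phase → ℂ) : ℝ := (H1normSq s h).sqrt

/-- "‖f‖_{ℋ^{-1,-s}} ≤ B" : f is B-bounded as a functional on ℋ^{1,s} -/
def DualBound (s : ℝ) (f : Phase → ℂ) (B : ℝ) : Prop :=
  ∀ h : Phase → ℂ, IsTest h → ‖∫ p : Phase, f p * h p‖ ≤ B * H1norm s h

def offRplus : Set ℂ := {z : ℂ | ¬(0 ≤ z.re ∧ z.im = 0)}

/-- branch of √z with Im √z > 0 for z ∉ [0,∞) -/
def sqrtBr (z : ℂ) : ℂ := if 0 ≤ z.im then z ^ ((1:ℂ)/2) else -(z ^ ((1:ℂ)/2))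

/-- R is (a) resolvent family for P = P₀ + W on the set S:
(P−z)(R z f) = f in the sense of distributions, for every f ∈ L². -/
def IsResolvent (V : ℝ → ℝ) (R : ℂ → Hsp →L[ℂ] Hsp) (S : Set ℂ) : Prop :=
  ∀ z ∈ S, ∀ f : Hsp, ∀ φ : Phase → ℂ, IsTest φ →
    ∫ p : Phase, (R z f) p * (KFPt V φ p - z * φ p) = ∫ p : Phase, (f : Phase → ℂ) p * φ p

/-- weighted L²-norm: norm of 𝓛^{2,s} -/
def wNorm (s : ℝ) (f : Phase → ℂ) : ℝ := (∫ p : Phase, ‖f p‖ ^ 2 * jbr (2 * s) p.1).sqrt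

/-- membership in 𝓛^{2,s} -/
def MemW (s : ℝ) (f : Phase → ℂ) : Prop :=
  AEStronglyMeasurable f (volume : Measure Phase) ∧
  Integrable (fun p : Phase => ‖f p‖ ^ 2 * jbr (2 * s) p.1)

/-- bilinear pairing ∫ f g -/
def pair (f g : Phase → ℂ) : ℂ := ∫ p : Phase, f p * g p

/-! ### The Gaussian profile -/

lemma psi0_pos (v : ℝ) : 0 < psi0 v := by
  unfold psi0; positivity

lemma hasDerivAt_psi0 (v : ℝ) : HasDerivAt psi0 (-(v / 2) * psi0 v) v := by
  have h : HasDerivAt (fun v : ℝ => -(v ^ 2) / 4) (-(v / 2)) v := by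
    have := ((hasDerivAt_id v).pow 2).neg.div_const 4
    refine this.congr_deriv ?_
    simp; ring
  refine (h.exp.const_mul ((2 * π) ^ (-(1:ℝ)/4))).congr_deriv ?_
  unfold psi0; ring

lemma contDiff_psi0 : ContDiff ℝ (⊤ : ℕ∞) psi0 := by
  unfold psi0; fun_prop

lemma continuous_psi0 : Continuous psi0 := contDiff_psi0.continuous

lemma integrable_sq_one_add_sq_mul_psi0 :
    Integrable (fun v : ℝ => ((1 + v ^ 2) * psi0 v) ^ 2) := by
  have h (k : ℕ) : Integrable (fun v : ℝ => v ^ k * Real.exp (-(1 / 2) * v ^ 2)) := by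
    have := integrable_rpow_mul_exp_neg_mul_sq (b := 1 / 2) (by norm_num) (s := k)
      (by have : (0:ℝ) ≤ k := k.cast_nonneg
          linarith)
    simpa using this
  refine ((((h 0).add ((h 2).const_mul 2)).add (h 4)).const_mul
    (((2 * π) ^ (-(1:ℝ)/4)) ^ 2)).congr (ae_of_all _ fun v => ?_)
  have he : Real.exp (-(v ^ 2) / 4) ^ 2 = Real.exp (-(1 / 2) * v ^ 2) := by
    rw [← Real.exp_nat_mul]; congr 1; push_cast; ring
  simp only [Pi.add_apply, psi0, mul_pow, he]
  ring

/-! ### Strip weights and dominated convergence -/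

/-- Indicator of the strip `|x| ≤ R` times `(1 + v²) ψ₀(v)`. -/
def stripWeight (R : ℝ) (p : Phase) : ℝ :=
  (Set.Icc (-R) R).indicator 1 p.1 * ((1 + p.2 ^ 2) * psi0 p.2)

lemma stripWeight_nonneg (R : ℝ) (p : Phase) : 0 ≤ stripWeight R p :=
  mul_nonneg (Set.indicator_nonneg (by simp) _)
    (mul_nonneg (by positivity) (psi0_pos _).le)

/-- `w` is integrable against every strip weight. -/
def StripIntegrable (w : Phase → ℂ) : Prop :=
  AEStronglyMeasurable w (volume : Measure Phase) ∧
    ∀ R : ℝ, Integrable (fun p : Phase => ‖w p‖ * stripWeight R p)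

lemma jbr_pos (s x : ℝ) : 0 < jbr s x := by
  unfold jbr; positivity

lemma continuous_jbr (s : ℝ) : Continuous (jbr s) := by
  unfold jbr
  exact Continuous.rpow_const (by fun_prop) fun x => Or.inl (by positivity)

lemma measurable_stripWeight (R : ℝ) : Measurable (stripWeight R) := by
  unfold stripWeight
  have h1 : Measurable ((Set.Icc (-R) R).indicator (1 : ℝ → ℝ)) :=
    measurable_one.indicator measurableSet_Icc
  have h2 := continuous_psi0.measurable
  fun_prop

lemma StripIntegrable.of_weighted {w : Phase → ℂ} {t : ℝ}
    (hw : AEStronglyMeasurable w (volume : Measure Phase))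
    (hi : Integrable (fun p : Phase => ‖w p‖ ^ 2 * jbr (2 * t) p.1)) : StripIntegrable w := by
  refine ⟨hw, fun R => ?_⟩
  have h1 : Integrable ((Set.Icc (-R) R).indicator fun x => (jbr (2 * t) x)⁻¹) := by
    rw [integrable_indicator_iff measurableSet_Icc]
    exact ((continuous_jbr _).inv₀ fun x => (jbr_pos _ x).ne').continuousOn.integrableOn_Icc
  have h2 := h1.mul_prod integrable_sq_one_add_sq_mul_psi0
  rw [← Measure.volume_eq_prod] at h2
  refine (hi.add h2).mono'
    (hw.norm.mul (measurable_stripWeight R).aestronglyMeasurable) (ae_of_all _ fun p => ?_)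
  rw [Real.norm_of_nonneg (mul_nonneg (norm_nonneg _) (stripWeight_nonneg _ _))]
  have hj := jbr_pos (2 * t) p.1
  simp only [Pi.add_apply, stripWeight]
  by_cases hp : p.1 ∈ Set.Icc (-R) R
  · simp only [Set.indicator_of_mem hp, Pi.one_apply, one_mul]
    generalize (1 + p.2 ^ 2) * psi0 p.2 = b
    generalize ‖w p‖ = a
    generalize jbr (2 * t) p.1 = c at hj
    have : a ^ 2 * c + c⁻¹ * b ^ 2 - a * b = c⁻¹ * ((a * c - b / 2) ^ 2 + 3 / 4 * b ^ 2) := by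
      field_simp; ring
    have h0 : 0 ≤ c⁻¹ * ((a * c - b / 2) ^ 2 + 3 / 4 * b ^ 2) := by positivity
    linarith
  · simp only [Set.indicator_of_notMem hp, zero_mul, mul_zero, add_zero]
    positivity

lemma StripIntegrable.integrable {w : Phase → ℂ} (hw : StripIntegrable w) {F : Phase → ℝ}
    (hF : Continuous F) {R B : ℝ} (hb : ∀ p, |F p| ≤ B * stripWeight R p) :
    Integrable (fun p => w p * (F p : ℂ)) := by
  refine ((hw.2 R).const_mul B).mono' (hw.1.mul (by fun_prop)) (ae_of_all _ fun p => ?_)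
  rw [norm_mul, Complex.norm_real, Real.norm_eq_abs]
  nlinarith [mul_le_mul_of_nonneg_left (hb p) (norm_nonneg (w p))]

lemma StripIntegrable.tendsto_integral {w : Phase → ℂ} (hw : StripIntegrable w)
    {F : ℕ → Phase → ℝ} {G : Phase → ℝ} (hF : ∀ n, Continuous (F n)) {R B : ℝ}
    (hb : ∀ n p, |F n p| ≤ B * stripWeight R p)
    (hlim : ∀ p, Tendsto (fun n => F n p) atTop (𝓝 (G p))) :
    Tendsto (fun n => ∫ p, w p * (F n p : ℂ)) atTop (𝓝 (∫ p, w p * (G p : ℂ))) := by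
  refine tendsto_integral_of_dominated_convergence (fun p => B * (‖w p‖ * stripWeight R p))
    (fun n => hw.1.mul (by have := hF n; fun_prop)) ((hw.2 R).const_mul B)
    (fun n => ae_of_all _ fun p => ?_) (ae_of_all _ fun p => ?_)
  · rw [norm_mul, Complex.norm_real, Real.norm_eq_abs]
    nlinarith [mul_le_mul_of_nonneg_left (hb n p) (norm_nonneg (w p))]
  · exact ((Complex.continuous_ofReal.tendsto _).comp (hlim p)).const_mul _

/-- A product of a bounded function supported in `[-R, R]` and a multiple of `(1 + v²) ψ₀(v)` is
bounded by a strip weight. -/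
lemma abs_mul_le_stripWeight {f : ℝ → ℝ} {R B C : ℝ} (hR : ∀ x, R < |x| → f x = 0)
    (hB : ∀ x, |f x| ≤ B) {a v : ℝ} (ha : |a| ≤ C * ((1 + v ^ 2) * psi0 v)) (x : ℝ) :
    |f x * a| ≤ B * C * stripWeight R (x, v) := by
  have hB0 : 0 ≤ B := (abs_nonneg _).trans (hB 0)
  unfold stripWeight
  by_cases hx : x ∈ Set.Icc (-R) R
  · simp only [Set.indicator_of_mem hx, Pi.one_apply, one_mul]
    rw [abs_mul, mul_assoc]
    exact mul_le_mul (hB x) ha (abs_nonneg _) hB0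
  · have : f x = 0 := hR x (by
      rw [Set.mem_Icc, ← abs_le] at hx
      exact not_le.1 hx)
    simp [this, Set.indicator_of_notMem hx]

lemma HasCompactSupport.exists_radius_bound {f : ℝ → ℝ} (hf : Continuous f)
    (hs : HasCompactSupport f) : ∃ R B : ℝ, (∀ x, R < |x| → f x = 0) ∧ ∀ x, |f x| ≤ B := by
  obtain ⟨B, hB⟩ := hs.exists_bound_of_continuous hf
  obtain ⟨R, hR⟩ := hs.isCompact.isBounded.subset_closedBall 0
  refine ⟨R, B, fun x hx => ?_, hB⟩
  by_contra h
  have := hR (subset_tsupport f h)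
  rw [mem_closedBall_zero_iff, Real.norm_eq_abs] at this
  linarith

/-! ### Smooth cutoffs -/

/-- A fixed smooth bump, equal to `1` on `[-1, 1]` and supported in `[-2, 2]`. -/
def unitBump : ContDiffBump (0 : ℝ) := ⟨1, 2, one_pos, one_lt_two⟩

/-- The bump `unitBump` rescaled by the factor `n + 1`. -/
def cutoff (n : ℕ) (x : ℝ) : ℝ := unitBump (((n : ℝ) + 1)⁻¹ * x)

lemma contDiff_unitBump : ContDiff ℝ (⊤ : ℕ∞) unitBump := unitBump.contDiff

lemma contDiff_cutoff (n : ℕ) : ContDiff ℝ (⊤ : ℕ∞) (cutoff n) :=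
  contDiff_unitBump.comp (contDiff_const.mul contDiff_id)

lemma hasCompactSupport_cutoff (n : ℕ) : HasCompactSupport (cutoff n) := by
  have h : ((n : ℝ) + 1)⁻¹ ≠ 0 := by positivity
  exact unitBump.hasCompactSupport.comp_homeomorph (Homeomorph.mulLeft₀ _ h)

lemma deriv_cutoff (n : ℕ) :
    deriv (cutoff n) = fun x => ((n : ℝ) + 1)⁻¹ * deriv unitBump (((n : ℝ) + 1)⁻¹ * x) := by
  funext x
  exact deriv_comp_mul_left _ _ _

lemma deriv_deriv_cutoff (n : ℕ) :
    deriv (deriv (cutoff n)) = fun x =>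
      ((n : ℝ) + 1)⁻¹ * (((n : ℝ) + 1)⁻¹ * deriv (deriv unitBump) (((n : ℝ) + 1)⁻¹ * x)) := by
  rw [deriv_cutoff]
  funext x
  rw [deriv_const_mul_field]
  congr 1
  exact deriv_comp_mul_left _ _ _

lemma cutoff_eventuallyEq_one (x : ℝ) : ∀ᶠ n in atTop, cutoff n =ᶠ[𝓝 x] fun _ => 1 := by
  obtain ⟨N, hN⟩ := exists_nat_gt |x|
  filter_upwards [eventually_ge_atTop N] with n hn
  have hx : |x| < n + 1 := by
    have : (N : ℝ) ≤ n := by exact_mod_cast hn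
    linarith
  filter_upwards [(continuous_abs.tendsto x).eventually (gt_mem_nhds hx)] with y hy
  refine unitBump.one_of_mem_closedBall ?_
  rw [mem_closedBall_zero_iff, Real.norm_eq_abs, abs_mul, abs_of_pos (by positivity)]
  change _ ≤ (1 : ℝ)
  rw [inv_mul_le_iff₀ (by positivity)]
  linarith

lemma exists_cutoff_bound : ∃ B : ℝ, 0 ≤ B ∧ ∀ n x, |cutoff n x| ≤ B ∧ |deriv (cutoff n) x| ≤ B ∧
    |deriv (deriv (cutoff n)) x| ≤ B := by
  have h1 : ContDiff ℝ 1 (deriv unitBump) := by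
    have h2 : ContDiff ℝ 2 unitBump := contDiff_infty.1 contDiff_unitBump 2
    exact ((contDiff_succ_iff_deriv (n := 1)).1 h2).2.2
  obtain ⟨B0, hB0⟩ := unitBump.hasCompactSupport.exists_bound_of_continuous unitBump.continuous
  obtain ⟨B1, hB1⟩ := unitBump.hasCompactSupport.deriv.exists_bound_of_continuous h1.continuous
  obtain ⟨B2, hB2⟩ := unitBump.hasCompactSupport.deriv.deriv.exists_bound_of_continuous
    (contDiff_one_iff_deriv.1 h1).2
  have hle : ∀ (n : ℕ) (a : ℝ), |((n : ℝ) + 1)⁻¹ * a| ≤ |a| := fun n a => by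
    rw [abs_mul, abs_of_pos (by positivity)]
    refine mul_le_of_le_one_left (abs_nonneg _) (inv_le_one_of_one_le₀ ?_)
    have : (0 : ℝ) ≤ n := n.cast_nonneg
    linarith
  have hn0 := (norm_nonneg _).trans (hB0 0)
  have hn1 := (norm_nonneg _).trans (hB1 0)
  have hn2 := (norm_nonneg _).trans (hB2 0)
  refine ⟨B0 + B1 + B2, by positivity, fun n x => ⟨?_, ?_, ?_⟩⟩
  · exact (hB0 _).trans (by linarith)
  · rw [deriv_cutoff]
    exact (hle _ _).trans ((hB1 _).trans (by linarith))
  · rw [deriv_deriv_cutoff]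
    exact (hle _ _).trans ((hle _ _).trans ((hB2 _).trans (by linarith)))

/-! ### Mollification -/

lemma exists_smooth_approx {f : ℝ → ℝ} (hf : Continuous f) (hs : HasCompactSupport f) :
    ∃ (F : ℕ → ℝ → ℝ) (R B : ℝ), (∀ n, ContDiff ℝ (⊤ : ℕ∞) (F n)) ∧
      (∀ n, HasCompactSupport (F n)) ∧
      (∀ n x, R < |x| → F n x = 0 ∧ deriv (F n) x = 0) ∧ (∀ n x, |F n x| ≤ B) ∧
      (∀ x, Tendsto (fun n => F n x) atTop (𝓝 (f x))) ∧
      (ContDiff ℝ 1 f → (∀ n x, |deriv (F n) x| ≤ B) ∧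
        ∀ x, Tendsto (fun n => deriv (F n) x) atTop (𝓝 (deriv f x))) := by
  let φ : ℕ → ContDiffBump (0 : ℝ) := fun n =>
    ⟨((n : ℝ) + 1)⁻¹ / 2, ((n : ℝ) + 1)⁻¹, by positivity, half_lt_self (by positivity)⟩
  have hφ : Tendsto (fun n => (φ n).rOut) atTop (𝓝 0) := by
    have := tendsto_one_div_add_atTop_nhds_zero_nat (𝕜 := ℝ)
    simpa [φ] using this
  have hbd : ∀ (n : ℕ) (g : ℝ → ℝ) (B : ℝ), Continuous g → (∀ x, |g x| ≤ B) →
      ∀ x, |(convolution ((φ n).normed volume) g (ContinuousLinearMap.lsmul ℝ ℝ) volume) x|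
        ≤ 3 * B := by
    intro n g B hg hB x
    have h := (φ n).dist_normed_convolution_le (x₀ := x) (μ := volume) (ε := 2 * B)
      hg.aestronglyMeasurable (fun y _ => by
        rw [Real.dist_eq]
        have := abs_sub (g y) (g x)
        linarith [hB y, hB x])
    rw [Real.dist_eq] at h
    have h3 := hB x
    rw [abs_le] at *
    constructor <;> linarith [h.1, h.2, h3.1, h3.2]
  obtain ⟨R, B, hR, hB⟩ := HasCompactSupport.exists_radius_bound hf hs
  have hsupp : ∀ n x, R + 1 < |x| →
      (convolution ((φ n).normed volume) f (ContinuousLinearMap.lsmul ℝ ℝ) volume) x = 0 := by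
    intro n x hx
    by_contra h
    obtain ⟨y, hy, z, hz, rfl⟩ := Set.mem_add.1 (support_convolution_subset _ h)
    rw [(φ n).support_normed_eq, mem_ball_zero_iff, Real.norm_eq_abs] at hy
    have hy1 : |y| < 1 := hy.trans_le (inv_le_one_of_one_le₀ (by
      have : (0 : ℝ) ≤ n := n.cast_nonneg
      linarith))
    have hz1 : |z| ≤ R := by
      by_contra hz'
      exact hz (hR z (not_le.1 hz'))
    linarith [abs_add_le y z]
  have hBn := (abs_nonneg _).trans (hB 0)
  have hFs : ∀ n, HasCompactSupport
      (convolution ((φ n).normed volume) f (ContinuousLinearMap.lsmul ℝ ℝ) volume) := fun n =>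
    HasCompactSupport.convolution _ (φ n).hasCompactSupport_normed hs
  have hd0 : ∀ n x, R + 1 < |x| →
      deriv (convolution ((φ n).normed volume) f (ContinuousLinearMap.lsmul ℝ ℝ) volume) x = 0 := by
    intro n x hx
    have : (convolution ((φ n).normed volume) f (ContinuousLinearMap.lsmul ℝ ℝ) volume)
        =ᶠ[𝓝 x] fun _ => 0 := by
      filter_upwards [(continuous_abs.tendsto x).eventually (lt_mem_nhds hx)] with y hy
      exact hsupp n y hy
    rw [this.deriv_eq, deriv_const]
  by_cases h1 : ContDiff ℝ 1 f
  · have hf' := (contDiff_one_iff_deriv.1 h1).2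
    obtain ⟨R', B', hR', hB'⟩ := HasCompactSupport.exists_radius_bound hf' hs.deriv
    have hBn' := (abs_nonneg _).trans (hB' 0)
    have hd : ∀ n x,
        deriv (convolution ((φ n).normed volume) f (ContinuousLinearMap.lsmul ℝ ℝ) volume) x =
        (convolution ((φ n).normed volume) (deriv f) (ContinuousLinearMap.lsmul ℝ ℝ) volume) x :=
      fun n x => (HasCompactSupport.hasDerivAt_convolution_right _
        (φ n).continuous_normed.locallyIntegrable hs h1 x).deriv
    refine ⟨_, R + 1, 3 * B + 3 * B', fun n => HasCompactSupport.contDiff_convolution_left _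
      (φ n).hasCompactSupport_normed (φ n).contDiff_normed hf.locallyIntegrable, hFs,
      fun n x hx => ⟨hsupp n x hx, hd0 n x hx⟩,
      fun n x => (hbd n f B hf hB x).trans (by linarith),
      fun x => ContDiffBump.convolution_tendsto_right_of_continuous hφ hf x, fun _ => ⟨?_, ?_⟩⟩
    · intro n x
      rw [hd]
      exact (hbd n _ B' hf' hB' x).trans (by linarith)
    · intro x
      simp_rw [hd]
      exact ContDiffBump.convolution_tendsto_right_of_continuous hφ hf' x
  · exact ⟨_, R + 1, 3 * B, fun n => HasCompactSupport.contDiff_convolution_left _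
      (φ n).hasCompactSupport_normed (φ n).contDiff_normed hf.locallyIntegrable, hFs,
      fun n x hx => ⟨hsupp n x hx, hd0 n x hx⟩,
      fun n x => hbd n f B hf hB x,
      fun x => ContDiffBump.convolution_tendsto_right_of_continuous hφ hf x,
      fun h => absurd h h1⟩

/-! ### Product test functions -/

/-- The function `(x, v) ↦ χ(x) b(v)`, viewed as complex valued. -/
def prodFun (χ b : ℝ → ℝ) (p : Phase) : ℂ := ((χ p.1 * b p.2 : ℝ) : ℂ)

lemma contDiff_prodFun {χ b : ℝ → ℝ} (hχ : ContDiff ℝ (⊤ : ℕ∞) χ) (hb : ContDiff ℝ (⊤ : ℕ∞) b) :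
    ContDiff ℝ (⊤ : ℕ∞) (prodFun χ b) :=
  Complex.ofRealCLM.contDiff.comp ((hχ.comp contDiff_fst).mul (hb.comp contDiff_snd))

lemma isTest_prodFun {χ b : ℝ → ℝ} (hχ : ContDiff ℝ (⊤ : ℕ∞) χ) (hχs : HasCompactSupport χ)
    (hb : ContDiff ℝ (⊤ : ℕ∞) b) (hbs : HasCompactSupport b) : IsTest (prodFun χ b) := by
  refine ⟨contDiff_prodFun hχ hb,
    HasCompactSupport.of_support_subset_isCompact (hχs.isCompact.prod hbs.isCompact) fun p hp => ?_⟩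
  have : χ p.1 * b p.2 ≠ 0 := by
    intro h
    exact hp (by simp only [prodFun, h, Complex.ofReal_zero])
  exact ⟨subset_tsupport _ (left_ne_zero_of_mul this), subset_tsupport _ (right_ne_zero_of_mul this)⟩

lemma dvD_eq_of_hasDerivAt {φ : Phase → ℂ} (hφ : Differentiable ℝ φ) {p : Phase} {d : ℂ}
    (h : HasDerivAt (fun t : ℝ => φ (p.1, t)) d p.2) : dvD φ p = d := by
  have h1 : HasDerivAt (fun t : ℝ => ((p.1, t) : Phase)) (0, 1) p.2 :=
    (hasDerivAt_const _ _).prodMk (hasDerivAt_id _)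
  exact ((hφ (p.1, p.2)).hasFDerivAt.comp_hasDerivAt p.2 h1).unique h

lemma dxD_eq_of_hasDerivAt {φ : Phase → ℂ} (hφ : Differentiable ℝ φ) {p : Phase} {d : ℂ}
    (h : HasDerivAt (fun t : ℝ => φ (t, p.2)) d p.1) : dxD φ p = d := by
  have h1 : HasDerivAt (fun t : ℝ => ((t, p.2) : Phase)) (1, 0) p.1 :=
    (hasDerivAt_id _).prodMk (hasDerivAt_const _ _)
  exact ((hφ (p.1, p.2)).hasFDerivAt.comp_hasDerivAt p.1 h1).unique h

lemma differentiable_prodFun {χ b : ℝ → ℝ} (hχ : Differentiable ℝ χ) (hb : Differentiable ℝ b) :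
    Differentiable ℝ (prodFun χ b) :=
  Complex.ofRealCLM.differentiable.comp
    ((hχ.comp differentiable_fst).mul (hb.comp differentiable_snd))

lemma dvD_prodFun {χ b : ℝ → ℝ} (hχ : Differentiable ℝ χ) (hb : Differentiable ℝ b) :
    dvD (prodFun χ b) = prodFun χ (deriv b) := by
  funext p
  exact dvD_eq_of_hasDerivAt (differentiable_prodFun hχ hb)
    (((hb p.2).hasDerivAt.const_mul (χ p.1)).ofReal_comp)

lemma dxD_prodFun {χ b : ℝ → ℝ} (hχ : Differentiable ℝ χ) (hb : Differentiable ℝ b) :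
    dxD (prodFun χ b) = prodFun (deriv χ) b := by
  funext p
  exact dxD_eq_of_hasDerivAt (differentiable_prodFun hχ hb)
    (((hχ p.1).hasDerivAt.mul_const (b p.2)).ofReal_comp)

/-! ### The truncated Gaussian -/

/-- `ψ₀` times a smooth cutoff. -/
def truncGauss (n : ℕ) (v : ℝ) : ℝ := psi0 v * cutoff n v

lemma contDiff_truncGauss (n : ℕ) : ContDiff ℝ (⊤ : ℕ∞) (truncGauss n) :=
  contDiff_psi0.mul (contDiff_cutoff n)

lemma hasCompactSupport_truncGauss (n : ℕ) : HasCompactSupport (truncGauss n) :=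
  (hasCompactSupport_cutoff n).mul_left

lemma ContDiff.deriv_infty {f : ℝ → ℝ} (hf : ContDiff ℝ (⊤ : ℕ∞) f) :
    ContDiff ℝ (⊤ : ℕ∞) (deriv f) :=
  (contDiff_infty_iff_deriv.1 hf).2

lemma ContDiff.differentiable_infty {f : ℝ → ℝ} (hf : ContDiff ℝ (⊤ : ℕ∞) f) :
    Differentiable ℝ f :=
  (contDiff_infty_iff_deriv.1 hf).1

lemma deriv_truncGauss (n : ℕ) : deriv (truncGauss n) =
    fun v => psi0 v * (-(v / 2) * cutoff n v + deriv (cutoff n) v) := by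
  funext v
  refine ((hasDerivAt_psi0 v).mul
    ((contDiff_cutoff n).differentiable_infty v).hasDerivAt).deriv.trans ?_
  ring

lemma deriv_deriv_truncGauss (n : ℕ) : deriv (deriv (truncGauss n)) = fun v =>
    psi0 v * ((v ^ 2 / 4 - 1 / 2) * cutoff n v - v * deriv (cutoff n) v
      + deriv (deriv (cutoff n)) v) := by
  rw [deriv_truncGauss]
  funext v
  have h0 := (contDiff_cutoff n).differentiable_infty v
  have h1 := (contDiff_cutoff n).deriv_infty.differentiable_infty v
  have h2 : HasDerivAt (fun v : ℝ => -(v / 2)) (-(1 / 2)) v :=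
    ((hasDerivAt_id v).div_const 2).neg
  refine ((hasDerivAt_psi0 v).mul ((h2.mul h0.hasDerivAt).add h1.hasDerivAt)).deriv.trans ?_
  simp only [Pi.add_apply, Pi.mul_apply]
  ring

lemma KFPt_prodFun_truncGauss (V : ℝ → ℝ) {χ : ℝ → ℝ} (hχ : ContDiff ℝ (⊤ : ℕ∞) χ) (n : ℕ)
    (p : Phase) : KFPt V (prodFun χ (truncGauss n)) p =
      ((deriv χ p.1 * (-(p.2 * psi0 p.2) * cutoff n p.2)
        + χ p.1 * (psi0 p.2 * (p.2 * deriv (cutoff n) p.2 - deriv (deriv (cutoff n)) p.2))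
        + deriv V p.1 * χ p.1 *
          (psi0 p.2 * (-(p.2 / 2) * cutoff n p.2 + deriv (cutoff n) p.2)) : ℝ) : ℂ) := by
  have hb := contDiff_truncGauss n
  have h2 : dvD (prodFun χ (truncGauss n)) = prodFun χ (deriv (truncGauss n)) :=
    dvD_prodFun hχ.differentiable_infty hb.differentiable_infty
  have h3 : dvD (prodFun χ (deriv (truncGauss n))) = prodFun χ (deriv (deriv (truncGauss n))) :=
    dvD_prodFun hχ.differentiable_infty hb.deriv_infty.differentiable_infty
  rw [KFPt, h2, h3, dxD_prodFun hχ.differentiable_infty hb.differentiable_infty,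
    deriv_deriv_truncGauss, deriv_truncGauss]
  simp only [prodFun, truncGauss]
  push_cast
  ring

lemma tendsto_of_eventually_cutoff {f : ℕ → ℝ} {a v : ℝ}
    (h : ∀ n, cutoff n =ᶠ[𝓝 v] (fun _ => 1) → f n = a) : Tendsto f atTop (𝓝 a) :=
  tendsto_const_nhds.congr' ((cutoff_eventuallyEq_one v).mono fun n hn => (h n hn).symm)

lemma Filter.EventuallyEq.deriv_cutoff_eq {n : ℕ} {v : ℝ} (h : cutoff n =ᶠ[𝓝 v] fun _ => 1) :
    cutoff n v = 1 ∧ deriv (cutoff n) v = 0 ∧ deriv (deriv (cutoff n)) v = 0 := by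
  refine ⟨h.eq_of_nhds, by rw [h.deriv_eq, deriv_const], ?_⟩
  rw [h.deriv.deriv_eq]
  simp

lemma abs_psi0_mul_le {a v C : ℝ} (h : |a| ≤ C * (1 + v ^ 2)) :
    |psi0 v * a| ≤ C * ((1 + v ^ 2) * psi0 v) := by
  rw [abs_mul, abs_of_pos (psi0_pos v)]
  nlinarith [mul_le_mul_of_nonneg_left h (psi0_pos v).le]

lemma abs_le_one_add_sq (v : ℝ) : |v| ≤ 1 + v ^ 2 := by
  rw [abs_le]
  constructor <;> nlinarith [sq_nonneg (v + 1), sq_nonneg (v - 1)]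

lemma abs_mul_add_le {a b c d B v : ℝ} (ha : |a| ≤ |v|) (hb : |b| ≤ B) (hc : |c| ≤ 1)
    (hd : |d| ≤ B) : |a * b + c * d| ≤ 2 * B * (1 + v ^ 2) := by
  have hB := (abs_nonneg _).trans hb
  have hv := abs_le_one_add_sq v
  have h1 : |a * b| ≤ (1 + v ^ 2) * B := by
    rw [abs_mul]
    exact mul_le_mul (ha.trans hv) hb (abs_nonneg _) (by positivity)
  have h2 : |c * d| ≤ (1 + v ^ 2) * B := by
    rw [abs_mul]
    exact mul_le_mul (hc.trans (by nlinarith [sq_nonneg v])) hd (abs_nonneg _) (by positivity)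
  linarith [abs_add_le (a * b) (c * d)]

/-! ### The flux identity -/

/-- The functional `f ↦ ∫ u(x, v) f(x) v ψ₀(v)`. -/
def flux (u : Phase → ℂ) (f : ℝ → ℝ) : ℂ :=
  ∫ p : Phase, u p * ((f p.1 * (p.2 * psi0 p.2) : ℝ) : ℂ)

lemma abs_mul_psi0_le (v : ℝ) : |v * psi0 v| ≤ 1 * ((1 + v ^ 2) * psi0 v) := by
  rw [mul_comm v]
  exact abs_psi0_mul_le (by rw [one_mul]; exact abs_le_one_add_sq v)

lemma integrable_flux {u : Phase → ℂ} (hu : StripIntegrable u) {f : ℝ → ℝ} (hf : Continuous f)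
    (hs : HasCompactSupport f) :
    Integrable (fun p : Phase => u p * ((f p.1 * (p.2 * psi0 p.2) : ℝ) : ℂ)) := by
  obtain ⟨R, B, hR, hB⟩ := HasCompactSupport.exists_radius_bound hf hs
  have := continuous_psi0
  exact hu.integrable (by fun_prop) fun p =>
    abs_mul_le_stripWeight hR hB (abs_mul_psi0_le p.2) p.1

lemma tendsto_flux {u : Phase → ℂ} (hu : StripIntegrable u) {F : ℕ → ℝ → ℝ} {f : ℝ → ℝ} {R B : ℝ}
    (hF : ∀ n, Continuous (F n)) (hR : ∀ n x, R < |x| → F n x = 0) (hB : ∀ n x, |F n x| ≤ B)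
    (hlim : ∀ x, Tendsto (fun n => F n x) atTop (𝓝 (f x))) :
    Tendsto (fun n => flux u (F n)) atTop (𝓝 (flux u f)) := by
  have := continuous_psi0
  exact hu.tendsto_integral (fun n => by have := hF n; fun_prop)
    (fun n p => abs_mul_le_stripWeight (hR n) (hB n) (abs_mul_psi0_le p.2) p.1)
    fun p => (hlim p.1).mul_const _

lemma flux_identity_smooth {V : ℝ → ℝ} (hV : ContDiff ℝ 1 V) {u : Phase → ℂ}
    (hu : StripIntegrable u)
    (hPu : ∀ φ : Phase → ℂ, IsTest φ → ∫ p : Phase, u p * KFPt V φ p = 0)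
    {χ : ℝ → ℝ} (hχ : ContDiff ℝ (⊤ : ℕ∞) χ) (hs : HasCompactSupport χ) :
    flux u (fun x => deriv χ x + 1 / 2 * (deriv V x * χ x)) = 0 := by
  have hV' := (contDiff_one_iff_deriv.1 hV).2
  have hχ' := hχ.deriv_infty.continuous
  have hχc := hχ.continuous
  have hψ := continuous_psi0
  obtain ⟨R0, B0, hR0, hB0⟩ := HasCompactSupport.exists_radius_bound hχc hs
  obtain ⟨R1, B1, hR1, hB1⟩ := HasCompactSupport.exists_radius_bound hχ' hs.deriv
  obtain ⟨R2, B2, hR2, hB2⟩ := HasCompactSupport.exists_radius_bound (hV'.mul hχc) hs.mul_left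
  obtain ⟨B, hBn, hB⟩ := exists_cutoff_bound
  have key := hu.tendsto_integral (R := max R0 (max R1 R2))
    (B := B1 * (2 * B) + B0 * (2 * B) + B2 * (2 * B))
    (F := fun n p => deriv χ p.1 * (-(p.2 * psi0 p.2) * cutoff n p.2)
        + χ p.1 * (psi0 p.2 * (p.2 * deriv (cutoff n) p.2 - deriv (deriv (cutoff n)) p.2))
        + deriv V p.1 * χ p.1 *
          (psi0 p.2 * (-(p.2 / 2) * cutoff n p.2 + deriv (cutoff n) p.2)))
    (G := fun p => -((deriv χ p.1 + 1 / 2 * (deriv V p.1 * χ p.1)) * (p.2 * psi0 p.2)))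
    (fun n => by
      have h0 := (contDiff_cutoff n).continuous
      have h1 := (contDiff_cutoff n).deriv_infty.continuous
      have h2 := (contDiff_cutoff n).deriv_infty.deriv_infty.continuous
      fun_prop)
    (fun n p => by
      obtain ⟨hc0, hc1, hc2⟩ := hB n p.2
      have e1 := abs_mul_le_stripWeight (R := max R0 (max R1 R2)) (C := 2 * B)
        (a := psi0 p.2 * (-p.2 * cutoff n p.2 + 0 * 0)) (v := p.2)
        (fun x hx => hR1 x (lt_of_le_of_lt (by simp) hx)) hB1
        (abs_psi0_mul_le (abs_mul_add_le (by simp) hc0 (by simp) (by simpa))) p.1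
      have e2 := abs_mul_le_stripWeight (R := max R0 (max R1 R2)) (C := 2 * B)
        (a := psi0 p.2 * (p.2 * deriv (cutoff n) p.2 + -1 * deriv (deriv (cutoff n)) p.2))
        (v := p.2)
        (fun x hx => hR0 x (lt_of_le_of_lt (by simp) hx)) hB0
        (abs_psi0_mul_le (abs_mul_add_le le_rfl hc1 (by simp) hc2)) p.1
      have e3 := abs_mul_le_stripWeight (R := max R0 (max R1 R2)) (C := 2 * B)
        (a := psi0 p.2 * (-(p.2 / 2) * cutoff n p.2 + 1 * deriv (cutoff n) p.2)) (v := p.2)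
        (fun x hx => hR2 x (lt_of_le_of_lt (by simp) hx)) hB2
        (abs_psi0_mul_le (abs_mul_add_le
          (by rw [abs_neg, abs_div, abs_two]; linarith [abs_nonneg p.2]) hc0 (by simp) hc1)) p.1
      refine (le_of_eq ?_).trans ((abs_add_three _ _ _).trans
        ((add_le_add (add_le_add e1 e2) e3).trans_eq (by ring)))
      congr 1
      rw [Pi.mul_apply]
      ring)
    (fun p => tendsto_of_eventually_cutoff (v := p.2) fun n hn => by
      obtain ⟨h0, h1, h2⟩ := hn.deriv_cutoff_eq
      simp only [h0, h1, h2]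
      ring)
  have hz : ∀ n, ∫ p : Phase, u p * ((deriv χ p.1 * (-(p.2 * psi0 p.2) * cutoff n p.2)
        + χ p.1 * (psi0 p.2 * (p.2 * deriv (cutoff n) p.2 - deriv (deriv (cutoff n)) p.2))
        + deriv V p.1 * χ p.1 *
          (psi0 p.2 * (-(p.2 / 2) * cutoff n p.2 + deriv (cutoff n) p.2)) : ℝ) : ℂ) = 0 :=
    fun n => by
      simp_rw [← KFPt_prodFun_truncGauss V hχ n]
      exact hPu _ (isTest_prodFun hχ hs (contDiff_truncGauss n) (hasCompactSupport_truncGauss n))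
  simp_rw [hz, Complex.ofReal_neg, mul_neg, integral_neg] at key
  exact neg_eq_zero.1 (tendsto_nhds_unique key tendsto_const_nhds)

lemma flux_identity {V : ℝ → ℝ} (hV : ContDiff ℝ 1 V) {u : Phase → ℂ}
    (hu : StripIntegrable u)
    (hPu : ∀ φ : Phase → ℂ, IsTest φ → ∫ p : Phase, u p * KFPt V φ p = 0)
    {χ : ℝ → ℝ} (hχ : ContDiff ℝ 1 χ) (hs : HasCompactSupport χ) :
    flux u (fun x => deriv χ x + 1 / 2 * (deriv V x * χ x)) = 0 := by
  have hV' := (contDiff_one_iff_deriv.1 hV).2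
  obtain ⟨F, R, B, hF, hFs, hR, hB, hlim, hd⟩ := exists_smooth_approx hχ.continuous hs
  obtain ⟨hB', hlim'⟩ := hd hχ
  obtain ⟨C, hC⟩ := (isCompact_Icc (a := -R) (b := R)).exists_bound_of_continuousOn
    hV'.continuousOn
  have hBn := (abs_nonneg _).trans (hB 0 0)
  have key := tendsto_flux hu (R := R) (B := B + 1 / 2 * (|C| * B))
    (F := fun n x => deriv (F n) x + 1 / 2 * (deriv V x * F n x))
    (fun n => by
      have h0 := (hF n).continuous
      have h1 := (hF n).deriv_infty.continuous
      fun_prop)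
    (fun n x hx => by simp [hR n x hx])
    (fun n x => by
      by_cases hx : |x| ≤ R
      · have h1 := hB n x
        have h2 := hB' n x
        have h3 : |deriv V x| ≤ |C| := (hC x (abs_le.1 hx)).trans (le_abs_self C)
        have h4 : |deriv V x * F n x| ≤ |C| * B := by
          rw [abs_mul]
          exact mul_le_mul h3 h1 (abs_nonneg _) (abs_nonneg _)
        have h5 : |1 / 2 * (deriv V x * F n x)| = 1 / 2 * |deriv V x * F n x| := by
          rw [abs_mul, abs_of_pos (by norm_num : (0:ℝ) < 1 / 2)]
        linarith [abs_add_le (deriv (F n) x) (1 / 2 * (deriv V x * F n x))]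
      · simp only [hR n x (not_le.1 hx), mul_zero, add_zero, abs_zero]
        positivity)
    (fun x => (hlim' x).add (((hlim x).const_mul _).const_mul _))
  simp_rw [flux_identity_smooth hV hu hPu (hF _) (hFs _)] at key
  exact tendsto_nhds_unique key tendsto_const_nhds

lemma integral_weakDv_mul {u g : Phase → ℂ} (hu : StripIntegrable u) (hg : StripIntegrable g)
    (hug : WeakDv u g) {f : ℝ → ℝ} (hf : Continuous f) (hs : HasCompactSupport f) :
    ∫ p : Phase, g p * ((f p.1 * psi0 p.2 : ℝ) : ℂ) = flux u (fun x => 1 / 2 * f x) := by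
  have hψ := continuous_psi0
  obtain ⟨F, R, B, hF, hFs, hR, hB, hlim, -⟩ := exists_smooth_approx hf hs
  obtain ⟨M, hMn, hM⟩ := exists_cutoff_bound
  have hL := hg.tendsto_integral (R := R) (B := B * M)
    (F := fun n p => F n p.1 * truncGauss n p.2) (G := fun p => f p.1 * psi0 p.2)
    (fun n => by
      have h0 := (hF n).continuous
      have h1 := (contDiff_truncGauss n).continuous
      fun_prop)
    (fun n p => abs_mul_le_stripWeight (fun x hx => (hR n x hx).1) (hB n)
      (abs_psi0_mul_le ((hM n p.2).1.trans (by nlinarith [sq_nonneg p.2]))) p.1)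
    (fun p => (hlim p.1).mul (tendsto_of_eventually_cutoff (v := p.2) fun n hn => by
      simp [truncGauss, hn.deriv_cutoff_eq.1]))
  have hRt := hu.tendsto_integral (R := R) (B := B * (2 * M))
    (F := fun n p => F n p.1 * deriv (truncGauss n) p.2)
    (G := fun p => -(1 / 2 * f p.1 * (p.2 * psi0 p.2)))
    (fun n => by
      have h0 := (hF n).continuous
      have h1 := (contDiff_truncGauss n).deriv_infty.continuous
      fun_prop)
    (fun n p => by
      obtain ⟨hc0, hc1, -⟩ := hM n p.2
      refine abs_mul_le_stripWeight (fun x hx => (hR n x hx).1) (hB n) ?_ p.1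
      have := abs_psi0_mul_le (abs_mul_add_le (v := p.2) (a := -(p.2 / 2)) (c := 1)
        (by rw [abs_neg, abs_div, abs_two]; linarith [abs_nonneg p.2]) hc0 (by simp) hc1)
      rw [one_mul] at this
      simpa only [deriv_truncGauss] using this)
    (fun p => by
      have h := (hlim p.1).mul (tendsto_of_eventually_cutoff (v := p.2)
        (f := fun n => deriv (truncGauss n) p.2) (a := psi0 p.2 * (-(p.2 / 2))) fun n hn => by
          simp [deriv_truncGauss, hn.deriv_cutoff_eq])
      convert h using 2
      ring)
  have heq : ∀ n, ∫ p : Phase, u p * ((F n p.1 * deriv (truncGauss n) p.2 : ℝ) : ℂ) =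
      -∫ p : Phase, g p * ((F n p.1 * truncGauss n p.2 : ℝ) : ℂ) := fun n => by
    have := hug _ (isTest_prodFun (hF n) (hFs n) (contDiff_truncGauss n)
      (hasCompactSupport_truncGauss n))
    rwa [dvD_prodFun (hF n).differentiable_infty (contDiff_truncGauss n).differentiable_infty]
      at this
  simp_rw [heq, Complex.ofReal_neg, mul_neg, integral_neg] at hRt
  have := tendsto_nhds_unique hRt hL.neg
  rw [flux, neg_inj.1 this]

/-! ### The flux is a multiple of `exp (V / 2)` -/

lemma flux_add {u : Phase → ℂ} (hu : StripIntegrable u) {f h : ℝ → ℝ} (hf : Continuous f)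
    (hfs : HasCompactSupport f) (hh : Continuous h) (hhs : HasCompactSupport h) :
    flux u (fun x => f x + h x) = flux u f + flux u h := by
  rw [flux, flux, flux, ← integral_add (integrable_flux hu hf hfs) (integrable_flux hu hh hhs)]
  refine integral_congr_ae (ae_of_all _ fun p => ?_)
  push_cast
  ring

lemma flux_const_mul (u : Phase → ℂ) (c : ℝ) (f : ℝ → ℝ) :
    flux u (fun x => c * f x) = c * flux u f := by
  rw [flux, flux, ← integral_const_mul]
  refine integral_congr_ae (ae_of_all _ fun p => ?_)
  push_cast
  ring

lemma exists_primitive_hasCompactSupport {h : ℝ → ℝ} (hh : Continuous h)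
    (hs : HasCompactSupport h) (h0 : ∫ x, h x = 0) :
    ∃ θ : ℝ → ℝ, (∀ x, HasDerivAt θ (h x) x) ∧ HasCompactSupport θ := by
  obtain ⟨R, -, hR, -⟩ := HasCompactSupport.exists_radius_bound hh hs
  refine ⟨fun x => ∫ t in (-(|R| + 1))..x, h t, fun x =>
    intervalIntegral.integral_hasDerivAt_right (hh.intervalIntegrable _ _)
      (hh.stronglyMeasurableAtFilter _ _) hh.continuousAt,
    HasCompactSupport.intro (isCompact_Icc (a := -(|R| + 1)) (b := |R| + 1)) fun x hx => ?_⟩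
  have hRR := le_abs_self R
  rw [Set.mem_Icc, not_and_or, not_le, not_le] at hx
  rcases hx with hx | hx
  · refine (intervalIntegral.integral_congr (g := fun _ => (0 : ℝ)) fun t ht => ?_).trans (by simp)
    rw [Set.uIcc_of_ge hx.le] at ht
    exact hR t (by have := neg_abs_le t; linarith [ht.2])
  · rw [intervalIntegral.integral_eq_integral_of_support_subset, h0]
    intro t ht
    have h1 : |t| ≤ R := not_lt.1 fun h' => ht (hR t h')
    have h2 := abs_le.1 h1
    constructor <;> linarith [h2.1, h2.2]

lemma flux_exp_mul_eq_zero {V : ℝ → ℝ} (hV : ContDiff ℝ 1 V) {u : Phase → ℂ}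
    (hu : StripIntegrable u)
    (hPu : ∀ φ : Phase → ℂ, IsTest φ → ∫ p : Phase, u p * KFPt V φ p = 0)
    {h : ℝ → ℝ} (hh : Continuous h) (hs : HasCompactSupport h) (h0 : ∫ x, h x = 0) :
    flux u (fun x => Real.exp (-(V x / 2)) * h x) = 0 := by
  obtain ⟨θ, hθ, hθs⟩ := exists_primitive_hasCompactSupport hh hs h0
  have hVd := (contDiff_one_iff_deriv.1 hV).1
  have hθ1 : ContDiff ℝ 1 θ := contDiff_one_iff_deriv.2
    ⟨fun x => (hθ x).differentiableAt, by rw [funext fun x => (hθ x).deriv]; exact hh⟩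
  have hχ : ContDiff ℝ 1 (fun x => Real.exp (-(V x / 2)) * θ x) := by fun_prop
  rw [← flux_identity hV hu hPu hχ hθs.mul_left]
  congr 1
  funext x
  have hd : deriv (fun x => Real.exp (-(V x / 2)) * θ x) x = _ := ((((hVd x).hasDerivAt.div_const 2).neg.exp).mul (hθ x)).deriv
  rw [hd]
  simp only [Pi.neg_apply]
  ring

lemma flux_exp_mul {V : ℝ → ℝ} (hV : ContDiff ℝ 1 V) {u : Phase → ℂ}
    (hu : StripIntegrable u)
    (hPu : ∀ φ : Phase → ℂ, IsTest φ → ∫ p : Phase, u p * KFPt V φ p = 0) :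
    ∃ c : ℂ, ∀ h : ℝ → ℝ, Continuous h → HasCompactSupport h →
      flux u (fun x => Real.exp (-(V x / 2)) * h x) = ((∫ x, h x : ℝ) : ℂ) * c := by
  let η : ℝ → ℝ := unitBump.normed volume
  have hη : Continuous η := unitBump.continuous_normed
  have hηs : HasCompactSupport η := unitBump.hasCompactSupport_normed
  have hη1 : ∫ x, η x = 1 := unitBump.integral_normed
  have hVc := hV.continuous
  refine ⟨flux u (fun x => Real.exp (-(V x / 2)) * η x), fun h hh hs => ?_⟩
  have hk : Continuous fun x => h x + (-∫ y, h y) * η x := by fun_prop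
  have hks : HasCompactSupport fun x => h x + (-∫ y, h y) * η x := hs.add hηs.mul_left
  have h0 : ∫ x, (h x + (-∫ y, h y) * η x) = 0 := by
    rw [integral_add (hh.integrable_of_hasCompactSupport hs)
      ((hη.integrable_of_hasCompactSupport hηs).const_mul _), integral_const_mul, hη1]
    ring
  have hz := flux_exp_mul_eq_zero hV hu hPu hk hks h0
  have he : (fun x => Real.exp (-(V x / 2)) * (h x + (-∫ y, h y) * η x)) = fun x =>
      Real.exp (-(V x / 2)) * h x + (-∫ y, h y) * (Real.exp (-(V x / 2)) * η x) := by
    funext x; ring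
  rw [he, flux_add hu (f := fun x => Real.exp (-(V x / 2)) * h x)
    (h := fun x => (-∫ y, h y) * (Real.exp (-(V x / 2)) * η x)) (by fun_prop) hs.mul_left (by fun_prop)
    hηs.mul_left.mul_left, flux_const_mul] at hz
  push_cast at hz ⊢
  linear_combination hz

/-! ### Decay of the potential -/

lemma tendsto_jbr_neg {ρ : ℝ} (hρ : 0 < ρ) {y : ℝ} (hy : y ≠ 0) :
    Tendsto (fun n : ℕ => jbr (-ρ) (((n : ℝ) + 1) * y)) atTop (𝓝 0) := by
  have h1 : Tendsto (fun n : ℕ => 1 + (((n : ℝ) + 1) * y) ^ 2) atTop atTop := by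
    refine tendsto_atTop_add_const_left _ _ ?_
    simp_rw [mul_pow]
    exact ((tendsto_pow_atTop two_ne_zero).comp
      (tendsto_atTop_add_const_right _ _ tendsto_natCast_atTop_atTop)).atTop_mul_const
      (by positivity)
  have h2 := (tendsto_rpow_neg_atTop (half_pos hρ)).comp h1
  refine h2.congr fun n => ?_
  simp [jbr, neg_div]

lemma jbr_neg_le_one {ρ : ℝ} (hρ : 0 < ρ) (x : ℝ) : jbr (-ρ) x ≤ 1 :=
  Real.rpow_le_one_of_one_le_of_nonpos (by nlinarith [sq_nonneg x]) (by linarith)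

lemma VDecay.abs_le {V : ℝ → ℝ} {ρ : ℝ} (hV : VDecay V ρ) :
    ∃ C : ℝ, 0 ≤ C ∧ ∀ x, |V x| ≤ C * jbr (-ρ) x := by
  obtain ⟨-, C, hC⟩ := hV
  refine ⟨|C|, abs_nonneg _, fun x => ?_⟩
  have h1 := hC x
  have h2 : 0 ≤ jbr 1 x * |deriv V x| := mul_nonneg (jbr_pos _ _).le (abs_nonneg _)
  nlinarith [mul_le_mul_of_nonneg_right (le_abs_self C) (jbr_pos (-ρ) x).le]

lemma integral_deriv_eq_zero_of_hasCompactSupport {f : ℝ → ℝ} (hf : ContDiff ℝ 1 f)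
    (hs : HasCompactSupport f) : ∫ x, deriv f x = 0 :=
  have h := contDiff_one_iff_deriv.1 hf
  integral_eq_zero_of_hasDerivAt_of_integrable (fun x => (h.1 x).hasDerivAt)
    (h.2.integrable_of_hasCompactSupport hs.deriv)
    (hf.continuous.integrable_of_hasCompactSupport hs)

lemma tendsto_integral_exp_mul_deriv_cutoff {V : ℝ → ℝ} {ρ : ℝ} (hρ : 0 < ρ)
    (hV : VDecay V ρ) :
    Tendsto (fun n => ∫ x, Real.exp (V x / 2) * deriv (cutoff n) x) atTop (𝓝 0) := by
  have hVc := hV.1.continuous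
  obtain ⟨C, hC0, hC⟩ := hV.abs_le
  have hβ1 : ContDiff ℝ 1 unitBump := contDiff_infty.1 contDiff_unitBump 1
  have hβ := (contDiff_one_iff_deriv.1 hβ1).2
  have hβs : HasCompactSupport (deriv unitBump) := unitBump.hasCompactSupport.deriv
  have hscale : ∀ n : ℕ, ∫ x, Real.exp (V x / 2) * deriv (cutoff n) x =
      ∫ y, Real.exp (V (((n : ℝ) + 1) * y) / 2) * deriv unitBump y := fun n => by
    have hn : (0 : ℝ) < (n : ℝ) + 1 := by positivity
    have h := Measure.integral_comp_mul_left
      (fun y => Real.exp (V (((n : ℝ) + 1) * y) / 2) * deriv unitBump y) ((n : ℝ) + 1)⁻¹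
    rw [inv_inv, abs_of_pos hn, smul_eq_mul] at h
    rw [← inv_mul_cancel_left₀ hn.ne'
      (∫ y, Real.exp (V (((n : ℝ) + 1) * y) / 2) * deriv unitBump y), ← h, ← integral_const_mul]
    refine integral_congr_ae (ae_of_all _ fun x => ?_)
    simp only [mul_inv_cancel_left₀ hn.ne', deriv_cutoff]
    ring
  have h0 := integral_deriv_eq_zero_of_hasCompactSupport hβ1 unitBump.hasCompactSupport
  refine Tendsto.congr (fun n => (hscale n).symm) (?_ : Tendsto _ _ (𝓝 (0 : ℝ)))
  refine Tendsto.mono_right (y := 𝓝 (∫ x, deriv unitBump x)) ?_ (congrArg 𝓝 h0).le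
  refine tendsto_integral_of_dominated_convergence
    (fun y => Real.exp (C / 2) * ‖deriv unitBump y‖)
    (fun n => by fun_prop)
    ((hβ.integrable_of_hasCompactSupport hβs).norm.const_mul _)
    (fun n => ae_of_all _ fun y => ?_) ?_
  · rw [norm_mul, Real.norm_of_nonneg (Real.exp_pos _).le]
    gcongr
    refine (le_abs_self _).trans ((hC _).trans ?_)
    exact mul_le_of_le_one_right hC0 (jbr_neg_le_one hρ _)
  · filter_upwards [compl_mem_ae_iff.2 (measure_singleton (0 : ℝ))] with y hy
    have h1 : Tendsto (fun n : ℕ => V (((n : ℝ) + 1) * y)) atTop (𝓝 0) :=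
      squeeze_zero_norm (fun n => hC _) (by simpa using (tendsto_jbr_neg hρ hy).const_mul C)
    have h2 := ((Real.continuous_exp.tendsto _).comp (h1.div_const 2)).mul_const
      (deriv unitBump y)
    simpa using h2

/-- **Lemma 4.1**. Let n = 1 and ρ > 0.  If u ∈ ℋ^{1,−s} for some s < ρ + 1/2 and u satisfies
Pu = 0 in the sense of distributions, then ⟨Wu, γ₀⟩ = 0.
Here g denotes the weak ∂ᵥ-derivative of u (part of the data of `MemH1`), so that
Wu = −V′(x) g, and γ₀(x,v) = ψ₀(v). -/
theorem statement11
    (V : ℝ → ℝ) (ρ : ℝ) (hρ : 0 < ρ) (hV : VDecay V ρ)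
    (s : ℝ) (hs : s < ρ + 1 / 2)
    (u g : Phase → ℂ) (hu : MemH1 (-s) u g)
    (hPu : ∀ φ : Phase → ℂ, IsTest φ → ∫ p : Phase, u p * KFPt V φ p = 0) :
    ∫ p : Phase, Wfun V g p * (starRingEnd ℂ) (gam0 p) = 0 := by
  obtain ⟨hum, hgm, hug, hui, hgi, -⟩ := hu
  have hus : StripIntegrable u := .of_weighted hum hui
  have hgs : StripIntegrable g := .of_weighted hgm hgi
  have hV' := (contDiff_one_iff_deriv.1 hV.1).2
  have hVc := hV.1.continuous
  by_cases hWi : Integrable fun p : Phase => Wfun V g p * (starRingEnd ℂ) (gam0 p)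
  swap
  · exact integral_undef hWi
  obtain ⟨c, hc⟩ := flux_exp_mul hV.1 hus hPu
  obtain ⟨B, -, hB⟩ := exists_cutoff_bound
  have hlim : Tendsto (fun n => ∫ p : Phase,
      ((cutoff n p.1 : ℝ) : ℂ) * (Wfun V g p * (starRingEnd ℂ) (gam0 p))) atTop
      (𝓝 (∫ p : Phase, Wfun V g p * (starRingEnd ℂ) (gam0 p))) := by
    refine tendsto_integral_of_dominated_convergence
      (fun p => B * ‖Wfun V g p * (starRingEnd ℂ) (gam0 p)‖)
      (fun n => ?_) (hWi.norm.const_mul B) (fun n => ae_of_all _ fun p => ?_)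
      (ae_of_all _ fun p => ?_)
    · have h0 := (contDiff_cutoff n).continuous
      exact (by fun_prop : Continuous fun p : Phase => ((cutoff n p.1 : ℝ) : ℂ))
        |>.aestronglyMeasurable.mul hWi.1
    · rw [norm_mul, Complex.norm_real]
      exact mul_le_mul_of_nonneg_right (hB n p.1).1 (norm_nonneg _)
    · refine tendsto_const_nhds.congr' ((cutoff_eventuallyEq_one p.1).mono fun n hn => ?_)
      simp only [hn.eq_of_nhds, Complex.ofReal_one, one_mul]
  have hval : ∀ n, ∫ p : Phase, ((cutoff n p.1 : ℝ) : ℂ) *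
      (Wfun V g p * (starRingEnd ℂ) (gam0 p)) =
      ((∫ x, Real.exp (V x / 2) * deriv (cutoff n) x : ℝ) : ℂ) * c := fun n => by
    have hχ : ContDiff ℝ 1 (cutoff n) := contDiff_infty.1 (contDiff_cutoff n) 1
    have hχs := hasCompactSupport_cutoff n
    have hχc := hχ.continuous
    have hχ' := (contDiff_one_iff_deriv.1 hχ).2
    have h1 := integral_weakDv_mul hus hgs hug (hV'.mul hχc) hχs.mul_left
    have h2 := flux_identity hV.1 hus hPu hχ hχs
    rw [flux_add hus (h := fun x => 1 / 2 * (deriv V x * cutoff n x)) hχ' hχs.deriv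
      (by fun_prop) hχs.mul_left.mul_left] at h2
    have h3 := hc (fun x => Real.exp (V x / 2) * deriv (cutoff n) x) (by fun_prop)
      hχs.deriv.mul_left
    have h4 : (fun x => Real.exp (-(V x / 2)) * (Real.exp (V x / 2) * deriv (cutoff n) x)) =
        deriv (cutoff n) := by
      funext x
      rw [← mul_assoc, ← Real.exp_add, neg_add_cancel, Real.exp_zero, one_mul]
    rw [h4] at h3
    rw [← h3, eq_neg_of_add_eq_zero_left h2]
    change _ = -flux u fun x => 1 / 2 * (deriv V * cutoff n) x
    rw [← h1, ← integral_neg]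
    refine integral_congr_ae (ae_of_all _ fun p => ?_)
    simp only [Wfun, gam0, Complex.conj_ofReal, Pi.mul_apply]
    push_cast
    ring
  simp_rw [hval] at hlim
  have hzero := ((Complex.continuous_ofReal.tendsto _).comp
    (tendsto_integral_exp_mul_deriv_cutoff hρ hV)).mul_const c
  rw [Complex.ofReal_zero, zero_mul] at hzero
  exact tendsto_nhds_unique hlim hzero

end
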